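/- Let Γ be a finite additive abelian group and let S₁, S₂ be finite subsets of Γ with 0 ∉ S₁ ∪ S₂; set S := S₁ ∪ S₂. If, for i = 1, 2, the lattice L(Sᵢ) contains |Sᵢ| ℤ-linearly independent nonnegative elements of degree ≤ dᵢ, then L(S) contains |S| ℤ-linearly independent nonnegative elements of degree ≤ max(d₁, d₂). (Paper's Proposition: γ_field(G, S) ≤ max(γ_field(G, S₁), γ_field(G, S₂)).) -/

import Mathlib

/-- For a finite subset `S` of an additive abelian group `Γ`, the lattice `L(S) ⊆ ℤ^S`:
functions `Γ → ℤ` vanishing outside `S` (the copy of `ℤ^S` inside `ℤ^Γ`) whose `S`-weighted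
sum vanishes in `Γ`. -/
def latG {Γ : Type*} [AddCommGroup Γ] (S : Finset Γ) : AddSubgroup (Γ → ℤ) where
  carrier := {a | (∀ χ ∉ S, a χ = 0) ∧ ∑ χ ∈ S, a χ • χ = 0}
  zero_mem' := by simp
  add_mem' := by
    intro a b ha hb
    refine ⟨fun χ hχ => ?_, ?_⟩
    · simp [ha.1 χ hχ, hb.1 χ hχ]
    · have h2 : ∑ χ ∈ S, (a + b) χ • χ = (∑ χ ∈ S, a χ • χ) + ∑ χ ∈ S, b χ • χ := by
        simp [Pi.add_apply, add_smul, Finset.sum_add_distrib]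
      rw [h2, ha.2, hb.2, add_zero]
  neg_mem' := by
    intro a ha
    refine ⟨fun χ hχ => ?_, ?_⟩
    · simp [ha.1 χ hχ]
    · have h2 : ∑ χ ∈ S, (-a) χ • χ = -∑ χ ∈ S, a χ • χ := by
        simp [Pi.neg_apply, neg_smul, Finset.sum_neg_distrib]
      rw [h2, ha.2, neg_zero]

/-- `L(S)` contains `|S|` `ℤ`-linearly independent nonnegative elements of degree `≤ d`. -/
def frLE {Γ : Type*} [AddCommGroup Γ] (S : Finset Γ) (d : ℕ) : Prop :=
  ∃ a : Fin S.card → (Γ → ℤ), (∀ j, a j ∈ latG S) ∧ LinearIndependent ℤ a ∧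
    (∀ j χ, 0 ≤ a j χ) ∧ ∀ j, ∑ χ ∈ S, a j χ ≤ (d : ℤ)

/-- The coordinatewise cast of integer-valued functions to rational-valued ones. -/
def castRat (Γ : Type*) : (Γ → ℤ) →ₗ[ℤ] (Γ → ℚ) where
  toFun a χ := a χ
  map_add' a b := by ext; simp
  map_smul' n a := by ext; simp

theorem castRat_injective (Γ : Type*) : Function.Injective (castRat Γ) := by
  intro a b h
  ext χ
  have h1 : ((a χ : ℤ) : ℚ) = b χ := congrFun h χ
  exact_mod_cast h1

theorem linearIndependent_castRat_comp {Γ ι : Type*} (a : ι → Γ → ℤ) :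
    LinearIndependent ℚ (castRat Γ ∘ a) ↔ LinearIndependent ℤ a := by
  rw [← LinearIndependent.iff_fractionRing ℤ ℚ]
  exact (castRat Γ).linearIndependent_iff_of_injOn (castRat_injective Γ).injOn

/-- Independent integer vectors supported on `S`, as many as `S` has elements, span all
rational functions supported on `S`. -/
theorem single_mem_span_castRat {Γ : Type*} [Finite Γ] [DecidableEq Γ] {S : Finset Γ}
    {a : Fin S.card → Γ → ℤ} (hS : ∀ j, ∀ χ ∉ S, a j χ = 0) (ha : LinearIndependent ℤ a)
    {χ : Γ} (hχ : χ ∈ S) :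
    (Pi.single χ 1 : Γ → ℚ) ∈ Submodule.span ℚ (Set.range (castRat Γ ∘ a)) := by
  have := Fintype.ofFinite Γ
  have hle : Submodule.span ℚ (Set.range (castRat Γ ∘ a)) ≤
      Submodule.span ℚ (S.image fun χ => (Pi.single χ 1 : Γ → ℚ) : Finset (Γ → ℚ)) := by
    rw [Submodule.span_le]
    rintro _ ⟨j, rfl⟩
    rw [SetLike.mem_coe, pi_eq_sum_univ' ((castRat Γ ∘ a) j)]
    refine Submodule.sum_mem _ fun ψ _ => ?_
    by_cases hψ : ψ ∈ S
    · refine Submodule.smul_mem _ _ (Submodule.subset_span ?_)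
      exact Finset.mem_coe.2 (Finset.mem_image_of_mem _ hψ)
    · have h : (castRat Γ ∘ a) j ψ = 0 := by simp [castRat, hS j ψ hψ]
      simp [h]
  have hrank : Module.finrank ℚ (Submodule.span ℚ (Set.range (castRat Γ ∘ a))) = S.card := by
    rw [finrank_span_eq_card ((linearIndependent_castRat_comp a).2 ha), Fintype.card_fin]
  rw [Submodule.eq_of_le_of_finrank_le hle
    (((finrank_span_finset_le_card _).trans Finset.card_image_le).trans_eq hrank.symm)]
  exact Submodule.subset_span (Finset.mem_coe.2 (Finset.mem_image_of_mem _ hχ))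

theorem latG_mono {Γ : Type*} [AddCommGroup Γ] {S T : Finset Γ} (h : S ⊆ T) :
    latG S ≤ latG T := by
  rintro a ⟨ha, hsum⟩
  refine ⟨fun χ hχ => ha χ fun hS => hχ (h hS), ?_⟩
  rw [← Finset.sum_subset h fun χ _ hχ => by simp [ha χ hχ], hsum]

/-- Let `Γ` be a finite additive abelian group and `S₁, S₂ ⊆ Γ` finite sets
avoiding `0`. If `L(Sᵢ)` contains `|Sᵢ|` independent nonnegative elements of degree `≤ dᵢ`
for `i = 1, 2`, then `L(S₁ ∪ S₂)` contains `|S₁ ∪ S₂|` independent nonnegative elements of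
degree `≤ max d₁ d₂`. -/
theorem stmt_8 (Γ : Type*) [AddCommGroup Γ] [Finite Γ] [DecidableEq Γ]
    (S₁ S₂ : Finset Γ) (h0 : (0 : Γ) ∉ S₁ ∪ S₂)
    (d₁ d₂ : ℕ) (h1 : frLE S₁ d₁) (h2 : frLE S₂ d₂) :
    frLE (S₁ ∪ S₂) (max d₁ d₂) := by
  obtain ⟨a₁, hL₁, hI₁, hN₁, hD₁⟩ := h1
  obtain ⟨a₂, hL₂, hI₂, hN₂, hD₂⟩ := h2
  obtain ⟨b, hbsub, hbspan, hb⟩ := exists_linearIndependent ℚ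
    (Set.range (castRat Γ ∘ a₁) ∪ Set.range (castRat Γ ∘ a₂))
  have hmem : ∀ χ : ↥(S₁ ∪ S₂), (Pi.single (χ : Γ) 1 : Γ → ℚ) ∈ Submodule.span ℚ b := by
    rintro ⟨χ, hχ⟩
    rw [hbspan]
    rcases Finset.mem_union.1 hχ with h | h
    · exact Submodule.span_mono Set.subset_union_left
        (single_mem_span_castRat (fun j => (hL₁ j).1) hI₁ h)
    · exact Submodule.span_mono Set.subset_union_right
        (single_mem_span_castRat (fun j => (hL₂ j).1) hI₂ h)
  have : Fintype b := hb.setFinite.fintype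
  have hcard : (S₁ ∪ S₂).card ≤ Fintype.card b := by
    have hsingle : LinearIndependent ℚ fun χ : ↥(S₁ ∪ S₂) => (Pi.single (χ : Γ) 1 : Γ → ℚ) :=
      (Pi.linearIndependent_single_one Γ ℚ).comp _ Subtype.val_injective
    rw [← Fintype.card_coe]
    exact linearIndependent_le_span_aux' _ hsingle b (Set.range_subset_iff.2 hmem)
  obtain ⟨e⟩ : Nonempty (Fin (S₁ ∪ S₂).card ↪ b) :=
    Function.Embedding.nonempty_of_card_le (by simpa using hcard)
  have hlift : ∀ x : b, ∃ a : Γ → ℤ, castRat Γ a = x ∧ a ∈ latG (S₁ ∪ S₂) ∧ (∀ χ, 0 ≤ a χ) ∧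
      ∑ χ ∈ S₁ ∪ S₂, a χ ≤ ((max d₁ d₂ : ℕ) : ℤ) := by
    rintro ⟨x, hx⟩
    rcases hbsub hx with ⟨j, rfl⟩ | ⟨j, rfl⟩
    · refine ⟨a₁ j, rfl, latG_mono Finset.subset_union_left (hL₁ j), hN₁ j, ?_⟩
      rw [← Finset.sum_subset Finset.subset_union_left fun χ _ hχ => (hL₁ j).1 χ hχ]
      exact (hD₁ j).trans (by exact_mod_cast le_max_left d₁ d₂)
    · refine ⟨a₂ j, rfl, latG_mono Finset.subset_union_right (hL₂ j), hN₂ j, ?_⟩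
      rw [← Finset.sum_subset Finset.subset_union_right fun χ _ hχ => (hL₂ j).1 χ hχ]
      exact (hD₂ j).trans (by exact_mod_cast le_max_right d₁ d₂)
  choose a hcast hL hN hD using hlift
  refine ⟨a ∘ e, fun j => hL _, ?_, fun j => hN _, fun j => hD _⟩
  rw [← linearIndependent_castRat_comp]
  have heq : castRat Γ ∘ a ∘ e = Subtype.val ∘ e := funext fun j => hcast (e j)
  rw [heq]
  exact hb.comp e e.injective
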